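/- There exists an absolute constant C > 0 such that for every w ∈ 𝔻 \ {0} the building-block function β_w satisfies: (i) sup_{a∈𝔻} ∫_𝔻 |β_w′(z)|² (1 − |φ_a(z)|²) dm(z) ≤ C, sup_{z∈𝔻} |β_w′(z)|(1−|z|²) ≤ C, and |β_w(0)| ≤ C; (ii) Re β_w(z) ≥ 0 for all z ∈ 𝔻; (iii) |Im β_w(z)| ≤ π/2 for all z ∈ 𝔻. -/

import Mathlib

open Complex MeasureTheory Set Filter

noncomputable section

/-- The open unit disc in the complex plane. -/
def unitDisc : Set ℂ := Metric.ball 0 1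

/-- The Möbius involution `φ_a(z) = (a - z)/(1 - conj(a) z)`. -/
def mobius (a z : ℂ) : ℂ := (a - z) / (1 - (starRingEnd ℂ) a * z)

/-- The hyperbolic distance on the unit disc. -/
def hypDist (a z : ℂ) : ℝ :=
  (1 / 2) * Real.log ((1 + ‖mobius a z‖) / (1 - ‖mobius a z‖))

/-- The `BMOA` Garsia-type seminorm squared at the point `a`, with normalized
area measure `dm = dx dy / π`. -/
def bmoaSemi (f : ℂ → ℂ) (a : ℂ) : ℝ :=
  (Real.pi)⁻¹ * ∫ z in unitDisc, ‖deriv f z‖ ^ 2 * (1 - ‖mobius a z‖ ^ 2)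

/-- `f` is an analytic function of bounded mean oscillation. -/
def IsBMOA (f : ℂ → ℂ) : Prop :=
  DifferentiableOn ℂ f unitDisc ∧ ∃ C : ℝ, ∀ a ∈ unitDisc, bmoaSemi f a ≤ C

/-- `f` is an analytic function of vanishing mean oscillation. -/
def IsVMOA (f : ℂ → ℂ) : Prop :=
  IsBMOA f ∧ ∀ ε > 0, ∃ r < 1, ∀ a ∈ unitDisc, r < ‖a‖ → bmoaSemi f a < ε

/-- The Bloch quantity `|f'(z)| (1 - |z|²)`. -/
def blochSemi (f : ℂ → ℂ) (z : ℂ) : ℝ := ‖deriv f z‖ * (1 - ‖z‖ ^ 2)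

/-- `f` belongs to the Bloch space. -/
def IsBloch (f : ℂ → ℂ) : Prop :=
  DifferentiableOn ℂ f unitDisc ∧ ∃ C : ℝ, ∀ z ∈ unitDisc, blochSemi f z ≤ C

/-- `f` belongs to the little Bloch space. -/
def IsLittleBloch (f : ℂ → ℂ) : Prop :=
  IsBloch f ∧ ∀ ε > 0, ∃ r < 1, ∀ z ∈ unitDisc, r < ‖z‖ → blochSemi f z < ε

/-- The `BMOA` norm `|f(0)| + ‖f‖_*`. -/
def bmoaNorm (f : ℂ → ℂ) : ℝ :=
  ‖f 0‖ + Real.sqrt (⨆ a : unitDisc, bmoaSemi f (a : ℂ))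

/-- The Bloch norm `|f(0)| + sup_z |f'(z)|(1-|z|²)`. -/
def blochNorm (f : ℂ → ℂ) : ℝ :=
  ‖f 0‖ + ⨆ z : unitDisc, blochSemi f (z : ℂ)

/-- `φ` is a semigroup of holomorphic self-maps of the unit disc. -/
def IsHoloSemigroup (φ : ℝ → ℂ → ℂ) : Prop :=
  (∀ t : ℝ, 0 ≤ t → DifferentiableOn ℂ (φ t) unitDisc ∧ MapsTo (φ t) unitDisc unitDisc) ∧
  (∀ z ∈ unitDisc, φ 0 z = z) ∧
  (∀ t : ℝ, 0 ≤ t → ∀ s : ℝ, 0 ≤ s → ∀ z ∈ unitDisc, φ (t + s) z = φ t (φ s z)) ∧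
  (∀ K ⊆ unitDisc, IsCompact K →
    TendstoUniformlyOn (fun t z => φ t z) id (nhdsWithin 0 (Ioi 0)) K)

/-- The maximal subspace of strong continuity `[φ_t, BMOA]`. -/
def maxSubspaceBMOA (φ : ℝ → ℂ → ℂ) : Set (ℂ → ℂ) :=
  {f | IsBMOA f ∧
    Tendsto (fun t => bmoaNorm (fun z => f (φ t z) - f z)) (nhdsWithin 0 (Ioi 0)) (nhds 0)}

/-- The maximal subspace of strong continuity `[φ_t, 𝓑]`. -/
def maxSubspaceBloch (φ : ℝ → ℂ → ℂ) : Set (ℂ → ℂ) :=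
  {f | IsBloch f ∧
    Tendsto (fun t => blochNorm (fun z => f (φ t z) - f z)) (nhdsWithin 0 (Ioi 0)) (nhds 0)}

/-- `G` is the infinitesimal generator of the semigroup `φ`. -/
def IsGenerator (φ : ℝ → ℂ → ℂ) (G : ℂ → ℂ) : Prop :=
  DifferentiableOn ℂ G unitDisc ∧
  ∀ z ∈ unitDisc,
    Tendsto (fun t : ℝ => (φ t z - z) / (t : ℂ)) (nhdsWithin 0 (Ioi 0)) (nhds (G z))

/-- The semigroup is elliptic: its Denjoy–Wolff point lies in the disc. -/
def IsElliptic (φ : ℝ → ℂ → ℂ) : Prop :=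
  ∃ τ ∈ unitDisc, ∀ t : ℝ, 0 ≤ t → φ t τ = τ

/-- The logarithmic vanishing Bloch condition (LVB) on a generator `G`. -/
def LVB (G : ℂ → ℂ) : Prop :=
  ∀ ε > 0, ∃ r < 1, ∀ z ∈ unitDisc, r < ‖z‖ →
    (1 - ‖z‖ ^ 2) / ‖G z‖ * Real.log (1 / (1 - ‖z‖ ^ 2)) < ε

/-- The logarithmic vanishing mean oscillation condition (LVMO) on a generator `G`. -/
def LVMO (G : ℂ → ℂ) : Prop :=
  ∀ ε > 0, ∃ r < 1, ∀ a ∈ unitDisc, r < ‖a‖ →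
    (Real.log (Real.exp 1 / (1 - ‖a‖ ^ 2))) ^ 2 *
      ((Real.pi)⁻¹ * ∫ z in unitDisc, (1 - ‖mobius a z‖ ^ 2) / ‖G z‖ ^ 2) < ε

/-- `f` belongs to the logarithmic little Bloch space `𝓑_{log,0}`. -/
def InBlochLog0 (f : ℂ → ℂ) : Prop :=
  ∀ ε > 0, ∃ r < 1, ∀ z ∈ unitDisc, r < ‖z‖ →
    ‖deriv f z‖ * (1 - ‖z‖ ^ 2) * Real.log (Real.exp 1 / (1 - ‖z‖ ^ 2)) < ε

/-- `f` belongs to `VMOA_log`. -/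
def InVMOAlog (f : ℂ → ℂ) : Prop :=
  ∀ ε > 0, ∃ r < 1, ∀ a ∈ unitDisc, r < ‖a‖ →
    (Real.log (Real.exp 1 / (1 - ‖a‖ ^ 2))) ^ 2 * bmoaSemi f a < ε

/-- Hyperbolic midpoint of the segment `[0, w]`. -/
def wstar (w : ℂ) : ℂ :=
  (((1 - Real.sqrt (1 - ‖w‖ ^ 2)) / ‖w‖ ^ 2 : ℝ) : ℂ) * w

/-- The building-block function `β_w(z) = Log(e / (1 + conj(w) φ_{w*}(z)))`. -/
def betaB (w z : ℂ) : ℂ :=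
  Complex.log ((Real.exp 1 : ℂ) / (1 + (starRingEnd ℂ) w * mobius (wstar w) z))

/-- The (invariant) Carleson box `S(I_u)` associated with a point `u ∈ 𝔻 \ {0}`. -/
def carlesonBox (u : ℂ) : Set ℂ :=
  {z ∈ unitDisc | ((starRingEnd ℂ) u * mobius u z).re ≤ 0}

/-- The generalized Volterra operator `T_g f(z) = ∫₀^z f(ζ) g'(ζ) dζ`. -/
def volterra (g f : ℂ → ℂ) (z : ℂ) : ℂ :=
  z * ∫ t in (0:ℝ)..1, f ((t : ℂ) * z) * deriv g ((t : ℂ) * z)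

lemma integral_exp_int_mul_I (k : ℤ) :
    ∫ t in Ioo (-Real.pi) Real.pi, Complex.exp ((k : ℂ) * I * t) =
      if k = 0 then 2 * (Real.pi : ℂ) else 0 := by
  rw [← integral_Ioc_eq_integral_Ioo,
    ← intervalIntegral.integral_of_le (by linarith [Real.pi_pos])]
  split_ifs with hk
  · simp [hk]
    ring
  · have hc : (k : ℂ) * I ≠ 0 := mul_ne_zero (by exact_mod_cast hk) I_ne_zero
    rw [integral_exp_mul_complex hc, div_eq_zero_iff, sub_eq_zero]
    left
    rw [Complex.exp_eq_exp_iff_exists_int]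
    exact ⟨k, by push_cast; ring⟩

lemma integral_radial_moment (n : ℕ) :
    ∫ r in Ioi (0 : ℝ), (Iio (1 : ℝ)).indicator
      (fun r => ((r * r ^ (2 * n) * (1 - r ^ 2) : ℝ) : ℂ)) r =
      ((1 / (2 * ((n + 1) * (n + 2))) : ℝ) : ℂ) := by
  rw [setIntegral_indicator measurableSet_Iio, Ioi_inter_Iio, ← integral_Ioc_eq_integral_Ioo,
    ← intervalIntegral.integral_of_le zero_le_one, intervalIntegral.integral_ofReal]
  congr 1
  have h : ∀ r : ℝ, r * r ^ (2 * n) * (1 - r ^ 2) = r ^ (2 * n + 1) - r ^ (2 * n + 3) := by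
    intro r; ring
  simp_rw [h]
  rw [intervalIntegral.integral_sub (Continuous.intervalIntegrable (by fun_prop) _ _)
    (Continuous.intervalIntegrable (by fun_prop) _ _), integral_pow, integral_pow]
  push_cast
  simp
  field_simp
  ring

/-- Monomials are orthogonal in the Bergman space with weight `1 - |z|²`. -/
lemma integral_unitDisc_monomial (n m : ℕ) :
    ∫ z in unitDisc, z ^ n * (starRingEnd ℂ) z ^ m * ((1 - ‖z‖ ^ 2 : ℝ) : ℂ) =
      if n = m then ((Real.pi * (1 / ((n + 1) * (n + 2))) : ℝ) : ℂ) else 0 := by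
  have hD : MeasurableSet unitDisc := measurableSet_ball
  rw [← integral_indicator hD, ← Complex.integral_comp_polarCoord_symm]
  change ∫ p in Ioi (0 : ℝ) ×ˢ Ioo (-Real.pi) Real.pi, _ = _
  have key : ∀ p ∈ Ioi (0 : ℝ) ×ˢ Ioo (-Real.pi) Real.pi,
      p.1 • unitDisc.indicator
        (fun z => z ^ n * (starRingEnd ℂ) z ^ m * ((1 - ‖z‖ ^ 2 : ℝ) : ℂ))
        (Complex.polarCoord.symm p) =
      (Iio (1 : ℝ)).indicator (fun r => ((r * r ^ (n + m) * (1 - r ^ 2) : ℝ) : ℂ)) p.1 *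
        Complex.exp (((n - m : ℤ) : ℂ) * I * p.2) := by
    rintro ⟨r, t⟩ ⟨hr, -⟩
    have hr : 0 < r := hr
    have hz : Complex.polarCoord.symm (r, t) = r * Complex.exp (t * I) := by
      rw [Complex.polarCoord_symm_apply, Complex.exp_mul_I]
      push_cast
      rfl
    have hn : ‖(r : ℂ) * Complex.exp (t * I)‖ = r := by
      rw [norm_mul, Complex.norm_exp_ofReal_mul_I, Complex.norm_real, Real.norm_of_nonneg hr.le,
        mul_one]
    rw [hz]
    by_cases h1 : r < 1
    · rw [indicator_of_mem (by simpa [unitDisc, abs_of_pos hr] using h1), indicator_of_mem (by exact h1), hn]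
      have he : Complex.exp (((n - m : ℤ) : ℂ) * I * t) =
          Complex.exp (t * I) ^ n * (starRingEnd ℂ) (Complex.exp (t * I)) ^ m := by
        rw [← Complex.exp_conj, ← Complex.exp_nat_mul, ← Complex.exp_nat_mul, ← Complex.exp_add]
        congr 1
        simp
        ring
      simp only [he, map_mul, conj_ofReal, real_smul]
      push_cast
      ring
    · rw [indicator_of_notMem (by simpa [unitDisc, abs_of_pos hr] using h1), indicator_of_notMem (by exact h1)]
      simp
  rw [setIntegral_congr_fun (measurableSet_Ioi.prod measurableSet_Ioo) key, Measure.volume_eq_prod,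
    setIntegral_prod_mul (L := ℂ) ((Iio (1 : ℝ)).indicator
      fun r => ((r * r ^ (n + m) * (1 - r ^ 2) : ℝ) : ℂ))
      (fun t : ℝ => Complex.exp (((n - m : ℤ) : ℂ) * I * t)), integral_exp_int_mul_I]
  by_cases h : n = m
  · subst h
    rw [← two_mul, integral_radial_moment]
    simp
    field_simp
  · rw [if_neg h, if_neg (by omega), mul_zero]

lemma integrableOn_unitDisc_of_continuous {E : Type*} [NormedAddCommGroup E] {f : ℂ → E}
    (hf : ContinuousOn f (Metric.closedBall 0 1)) : IntegrableOn f unitDisc :=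
  (hf.integrableOn_compact (isCompact_closedBall 0 1)).mono_set Metric.ball_subset_closedBall

lemma integral_unitDisc_norm_sq_polynomial (c : ℕ → ℂ) (N : ℕ) :
    ∫ z in unitDisc, ‖∑ n ∈ Finset.range N, c n * z ^ n‖ ^ 2 * (1 - ‖z‖ ^ 2) =
      Real.pi * ∑ n ∈ Finset.range N, ‖c n‖ ^ 2 / ((n + 1) * (n + 2)) := by
  apply Complex.ofReal_injective
  rw [← integral_complex_ofReal]
  have key : ∀ z : ℂ, ((‖∑ n ∈ Finset.range N, c n * z ^ n‖ ^ 2 * (1 - ‖z‖ ^ 2) : ℝ) : ℂ) =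
      ∑ n ∈ Finset.range N, ∑ m ∈ Finset.range N, c n * (starRingEnd ℂ) (c m) *
        (z ^ n * (starRingEnd ℂ) z ^ m * ((1 - ‖z‖ ^ 2 : ℝ) : ℂ)) := by
    intro z
    rw [Complex.ofReal_mul, Complex.ofReal_pow, ← Complex.mul_conj', map_sum,
      Finset.sum_mul_sum, Finset.sum_mul]
    refine Finset.sum_congr rfl fun n _ => ?_
    rw [Finset.sum_mul]
    refine Finset.sum_congr rfl fun m _ => ?_
    simp only [map_mul, map_pow]
    ring
  have hint : ∀ n m : ℕ, IntegrableOn (fun z : ℂ => c n * (starRingEnd ℂ) (c m) *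
      (z ^ n * (starRingEnd ℂ) z ^ m * ((1 - ‖z‖ ^ 2 : ℝ) : ℂ))) unitDisc := fun n m =>
    integrableOn_unitDisc_of_continuous (by fun_prop)
  simp_rw [key]
  rw [integral_finsetSum _ fun n _ => integrable_finsetSum _ fun m _ => hint n m]
  simp_rw [integral_finsetSum _ fun m _ => hint _ m, integral_const_mul,
    integral_unitDisc_monomial, mul_ite, mul_zero, Finset.sum_ite_eq]
  rw [Finset.mul_sum, Complex.ofReal_sum]
  refine Finset.sum_congr rfl fun n hn => ?_
  rw [if_pos hn, Complex.mul_conj']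
  push_cast
  ring

/-- The elementary estimate behind Carleson-measure bounds for products of two kernels. -/
lemma norm_sq_sum_antidiagonal_le {α β : ℂ} (hα : ‖α‖ < 1) (hβ : ‖β‖ ≤ 1) (n : ℕ) :
    (1 - ‖α‖) * (‖∑ kl ∈ Finset.HasAntidiagonal.antidiagonal n, α ^ kl.1 * β ^ kl.2‖ ^ 2 /
      ((n + 1) * (n + 2))) ≤
      4 * (1 / (1 + (1 - ‖α‖) * n) - 1 / (1 + (1 - ‖α‖) * (n + 1 : ℕ))) := by
  set c := ‖∑ kl ∈ Finset.HasAntidiagonal.antidiagonal n, α ^ kl.1 * β ^ kl.2‖ with hc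
  have h0 : c ≤ ∑ k ∈ Finset.range (n + 1), ‖α‖ ^ k := by
    refine (norm_sum_le _ _).trans ?_
    rw [Finset.Nat.sum_antidiagonal_eq_sum_range_succ (fun i j => ‖α ^ i * β ^ j‖)]
    refine Finset.sum_le_sum fun k _ => ?_
    rw [norm_mul, norm_pow, norm_pow]
    exact mul_le_of_le_one_right (by positivity) (pow_le_one₀ (norm_nonneg _) hβ)
  have h1 : c ≤ n + 1 := by
    refine h0.trans ((Finset.sum_le_card_nsmul _ _ 1 fun k _ =>
      pow_le_one₀ (norm_nonneg _) hα.le).trans ?_)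
    simp
  have h2 : (1 - ‖α‖) * c ≤ 1 := by
    have := geom_sum_mul_neg ‖α‖ (n + 1)
    have h3 : 0 ≤ ‖α‖ ^ (n + 1) := by positivity
    nlinarith [mul_le_mul_of_nonneg_right h0 (sub_nonneg.2 hα.le)]
  have hc0 : 0 ≤ c := norm_nonneg _
  clear_value c
  obtain ⟨d, hd⟩ : ∃ d, d = 1 - ‖α‖ := ⟨_, rfl⟩
  have hd0 : 0 < d := by linarith
  rw [← hd] at h2 ⊢
  have hn : (0 : ℝ) ≤ n := n.cast_nonneg
  push_cast
  generalize (n : ℝ) = x at *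
  have h3 : c * (1 + d * (x + 1)) ≤ 2 * (x + 1) := by nlinarith
  have h4 : (c * (1 + d * (x + 1))) ^ 2 ≤ (2 * (x + 1)) ^ 2 := by gcongr
  have h5 : c ^ 2 / ((x + 1) * (x + 2)) ≤ 4 / (1 + d * (x + 1)) ^ 2 := by
    rw [div_le_div_iff₀ (by positivity) (by positivity)]
    nlinarith
  have h6 : 4 * (1 / (1 + d * x) - 1 / (1 + d * (x + 1))) =
      d * (4 / ((1 + d * x) * (1 + d * (x + 1)))) := by
    field_simp
    ring
  rw [h6]
  refine mul_le_mul_of_nonneg_left (h5.trans ?_) hd0.le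
  gcongr
  rw [sq]
  gcongr
  linarith

lemma one_sub_mul_ne_zero {α z : ℂ} (hα : ‖α‖ < 1) (hz : ‖z‖ ≤ 1) : 1 - α * z ≠ 0 := by
  intro h
  have h1 : ‖α * z‖ = 1 := by rw [← sub_eq_zero.1 h, norm_one]
  rw [norm_mul] at h1
  nlinarith [norm_nonneg α, norm_nonneg z]

lemma sum_norm_sq_antidiagonal_le {α β : ℂ} (hα : ‖α‖ < 1) (hβ : ‖β‖ ≤ 1) (N : ℕ) :
    ∑ n ∈ Finset.range N, ‖∑ kl ∈ Finset.HasAntidiagonal.antidiagonal n,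
      α ^ kl.1 * β ^ kl.2‖ ^ 2 / (((n : ℝ) + 1) * (n + 2)) ≤ 4 / (1 - ‖α‖) := by
  have hd : 0 < 1 - ‖α‖ := by linarith
  rw [le_div_iff₀' hd, Finset.mul_sum]
  refine (Finset.sum_le_sum fun n _ => norm_sq_sum_antidiagonal_le hα hβ n).trans ?_
  rw [← Finset.mul_sum, Finset.sum_range_sub' (fun n : ℕ => 1 / (1 + (1 - ‖α‖) * (n : ℝ)))]
  have : 0 ≤ 1 / (1 + (1 - ‖α‖) * (N : ℝ)) := by positivity
  simp only [Nat.cast_zero, mul_zero, add_zero, div_one]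
  linarith

lemma integral_unitDisc_kernel_mul_kernel_le {α β : ℂ} (hα : ‖α‖ < 1) (hβ : ‖β‖ < 1) :
    ∫ z in unitDisc, ‖(1 - α * z)⁻¹ * (1 - β * z)⁻¹‖ ^ 2 * (1 - ‖z‖ ^ 2) ≤
      Real.pi * (4 / (1 - ‖α‖)) := by
  set c : ℕ → ℂ := fun n => ∑ kl ∈ Finset.HasAntidiagonal.antidiagonal n, α ^ kl.1 * β ^ kl.2
    with hc
  have hs : ∀ {γ : ℂ}, ‖γ‖ < 1 → Summable fun n : ℕ => ‖γ ^ n‖ := fun hγ => by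
    simpa using summable_geometric_of_lt_one (norm_nonneg _) hγ
  have hcs : Summable fun n => ‖c n‖ :=
    summable_norm_sum_mul_antidiagonal_of_summable_norm (hs hα) (hs hβ)
  have hlt : ∀ {γ z : ℂ}, ‖γ‖ < 1 → z ∈ unitDisc → ‖γ * z‖ < 1 := fun {γ z} hγ hz => by
    have hz : ‖z‖ < 1 := by simpa [unitDisc] using hz
    rw [norm_mul]
    nlinarith [norm_nonneg γ, norm_nonneg z]
  have hF : ∀ z ∈ unitDisc, HasSum (fun n => c n * z ^ n) ((1 - α * z)⁻¹ * (1 - β * z)⁻¹) := by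
    intro z hz
    have h1 := hs (hlt hα hz)
    have h2 := hs (hlt hβ hz)
    have h3 : ∀ n, ∑ kl ∈ Finset.HasAntidiagonal.antidiagonal n,
        (α * z) ^ kl.1 * (β * z) ^ kl.2 = c n * z ^ n := by
      intro n
      rw [hc, Finset.sum_mul]
      refine Finset.sum_congr rfl fun kl hkl => ?_
      rw [← Finset.HasAntidiagonal.mem_antidiagonal.1 hkl]
      ring
    rw [← tsum_geometric_of_norm_lt_one (hlt hα hz), ← tsum_geometric_of_norm_lt_one (hlt hβ hz),
      tsum_mul_tsum_eq_tsum_sum_antidiagonal_of_summable_norm h1 h2]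
    have h4 := (summable_norm_sum_mul_antidiagonal_of_summable_norm h1 h2).of_norm
    simp_rw [h3] at h4 ⊢
    exact h4.hasSum
  have hD : MeasurableSet unitDisc := measurableSet_ball
  have hb : ∀ N : ℕ, ∀ z ∈ unitDisc, ‖∑ n ∈ Finset.range N, c n * z ^ n‖ ≤ ∑' n, ‖c n‖ := by
    intro N z hz
    have hz : ‖z‖ < 1 := by simpa [unitDisc] using hz
    refine (norm_sum_le _ _).trans (le_trans (Finset.sum_le_sum fun n _ => ?_)
      (hcs.sum_le_tsum (Finset.range N) fun n _ => norm_nonneg _))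
    rw [norm_mul, norm_pow]
    exact mul_le_of_le_one_right (norm_nonneg _) (pow_le_one₀ (norm_nonneg _) hz.le)
  have hlim : Tendsto (fun N : ℕ => ∫ z in unitDisc,
      ‖∑ n ∈ Finset.range N, c n * z ^ n‖ ^ 2 * (1 - ‖z‖ ^ 2)) atTop
      (nhds (∫ z in unitDisc, ‖(1 - α * z)⁻¹ * (1 - β * z)⁻¹‖ ^ 2 * (1 - ‖z‖ ^ 2))) := by
    refine tendsto_integral_of_dominated_convergence (fun _ => (∑' n, ‖c n‖) ^ 2)
      (fun N => (Continuous.aestronglyMeasurable (by fun_prop)))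
      (integrableOn_unitDisc_of_continuous continuousOn_const)
      (fun N => (ae_restrict_iff' hD).2 (ae_of_all _ fun z hz => ?_))
      ((ae_restrict_iff' hD).2 (ae_of_all _ fun z hz => ?_))
    · have hz1 : ‖z‖ < 1 := by simpa [unitDisc] using hz
      have h1 : 0 ≤ 1 - ‖z‖ ^ 2 := by nlinarith [norm_nonneg z]
      rw [Real.norm_of_nonneg (by positivity)]
      refine (mul_le_of_le_one_right (by positivity) (by nlinarith [norm_nonneg z])).trans ?_
      gcongr
      exact hb N z hz
    · exact (((hF z hz).tendsto_sum_nat.norm).pow 2).mul_const _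
  refine le_of_tendsto' hlim fun N => ?_
  rw [integral_unitDisc_norm_sq_polynomial]
  exact mul_le_mul_of_nonneg_left (sum_norm_sq_antidiagonal_le hα hβ.le N) Real.pi_pos.le

lemma norm_conj_lt_one {a : ℂ} (ha : a ∈ unitDisc) : ‖(starRingEnd ℂ) a‖ < 1 := by
  rw [RCLike.norm_conj]
  simpa [unitDisc] using ha

lemma one_sub_norm_mobius_sq {a z : ℂ} (ha : a ∈ unitDisc) (hz : z ∈ unitDisc) :
    1 - ‖mobius a z‖ ^ 2 =
      (1 - ‖a‖ ^ 2) * (‖(1 - (starRingEnd ℂ) a * z)⁻¹‖ ^ 2 * (1 - ‖z‖ ^ 2)) := by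
  have hz' : ‖z‖ < 1 := by simpa [unitDisc] using hz
  have h := norm_pos_iff.2 (one_sub_mul_ne_zero (norm_conj_lt_one ha) hz'.le)
  have key : ‖1 - (starRingEnd ℂ) a * z‖ ^ 2 - ‖a - z‖ ^ 2 = (1 - ‖a‖ ^ 2) * (1 - ‖z‖ ^ 2) := by
    simp only [← Complex.normSq_eq_norm_sq, Complex.normSq_apply]
    simp
    ring
  rw [mobius, norm_div, norm_inv, inv_pow, div_pow]
  generalize ‖1 - (starRingEnd ℂ) a * z‖ = d at *
  field_simp
  linarith

lemma one_sub_norm_mobius_sq_nonneg {a z : ℂ} (ha : a ∈ unitDisc) (hz : z ∈ unitDisc) :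
    0 ≤ 1 - ‖mobius a z‖ ^ 2 := by
  have h1 : ‖a‖ < 1 := by simpa [unitDisc] using ha
  have h2 : ‖z‖ < 1 := by simpa [unitDisc] using hz
  have h3 : 0 ≤ 1 - ‖a‖ ^ 2 := by nlinarith [norm_nonneg a]
  have h4 : 0 ≤ 1 - ‖z‖ ^ 2 := by nlinarith [norm_nonneg z]
  rw [one_sub_norm_mobius_sq ha hz]
  positivity

lemma continuousOn_inv_one_sub_mul {α : ℂ} (hα : ‖α‖ < 1) :
    ContinuousOn (fun z : ℂ => (1 - α * z)⁻¹) (Metric.closedBall 0 1) :=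
  ContinuousOn.inv₀ (by fun_prop) fun z hz =>
    one_sub_mul_ne_zero hα (by simpa using hz)

lemma eqOn_kernel_weight {a : ℂ} (ha : a ∈ unitDisc) (β : ℂ) :
    EqOn (fun z => ‖(1 - β * z)⁻¹‖ ^ 2 * (1 - ‖mobius a z‖ ^ 2))
      (fun z => (1 - ‖a‖ ^ 2) *
        (‖(1 - (starRingEnd ℂ) a * z)⁻¹ * (1 - β * z)⁻¹‖ ^ 2 * (1 - ‖z‖ ^ 2))) unitDisc := by
  intro z hz
  simp only [one_sub_norm_mobius_sq ha hz, norm_mul]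
  ring

lemma integrableOn_kernel_weight {a β : ℂ} (ha : a ∈ unitDisc) (hβ : ‖β‖ < 1) :
    IntegrableOn (fun z => ‖(1 - β * z)⁻¹‖ ^ 2 * (1 - ‖mobius a z‖ ^ 2)) unitDisc := by
  refine IntegrableOn.congr_fun ?_ (eqOn_kernel_weight ha β).symm measurableSet_ball
  apply integrableOn_unitDisc_of_continuous
  have h1 := continuousOn_inv_one_sub_mul (norm_conj_lt_one ha)
  have h2 := continuousOn_inv_one_sub_mul hβ
  fun_prop

/-- The functions `log (1 - β z)` have uniformly bounded `BMOA` seminorm. -/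
lemma integral_kernel_weight_le {a β : ℂ} (ha : a ∈ unitDisc) (hβ : ‖β‖ < 1) :
    ∫ z in unitDisc, ‖(1 - β * z)⁻¹‖ ^ 2 * (1 - ‖mobius a z‖ ^ 2) ≤ Real.pi * 8 := by
  have ha1 : ‖a‖ < 1 := by simpa [unitDisc] using ha
  have h0 : 0 < 1 - ‖a‖ := by linarith
  rw [setIntegral_congr_fun (s := unitDisc) measurableSet_ball (eqOn_kernel_weight ha β), integral_const_mul]
  have h := integral_unitDisc_kernel_mul_kernel_le (norm_conj_lt_one ha) hβ
  rw [RCLike.norm_conj] at h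
  refine (mul_le_mul_of_nonneg_left h (by nlinarith [norm_nonneg a])).trans ?_
  have : (1 - ‖a‖ ^ 2) * (Real.pi * (4 / (1 - ‖a‖))) = Real.pi * (4 * (1 + ‖a‖)) := by
    field_simp
    ring
  rw [this]
  gcongr
  linarith

/-- `1 + conj(w) φ_{w*}` is a positive multiple of a quotient of two kernels. -/
lemma exists_kernel_quotient {w : ℂ} (hw : w ∈ unitDisc) (hw0 : w ≠ 0) :
    wstar w ∈ unitDisc ∧ ∃ (β : ℂ) (k : ℝ), ‖β‖ < 1 ∧ 1 ≤ k ∧ ∀ z ∈ unitDisc,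
      1 + (starRingEnd ℂ) w * mobius (wstar w) z =
        k * (1 - β * z) / (1 - (starRingEnd ℂ) (wstar w) * z) := by
  have hr : ‖w‖ < 1 := by simpa [unitDisc] using hw
  have hr0 : 0 < ‖w‖ := norm_pos_iff.2 hw0
  obtain ⟨s, hs⟩ : ∃ s, s = Real.sqrt (1 - ‖w‖ ^ 2) := ⟨_, rfl⟩
  have hs2 : s ^ 2 = 1 - ‖w‖ ^ 2 := by rw [hs, Real.sq_sqrt (by nlinarith)]
  have hs0 : 0 < s := by rw [hs]; exact Real.sqrt_pos.2 (by nlinarith)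
  have hs1 : s < 1 := by nlinarith
  have hw' : wstar w = ((1 / (1 + s) : ℝ) : ℂ) * w := by
    rw [wstar, ← hs]
    congr 2
    rw [div_eq_div_iff (by positivity) (by positivity)]
    linarith
  have hstar : wstar w ∈ unitDisc := by
    rw [unitDisc, mem_ball_zero_iff, hw', norm_mul, Complex.norm_real,
      Real.norm_of_nonneg (by positivity), one_div_mul_eq_div, div_lt_one (by positivity)]
    linarith
  refine ⟨hstar, (((2 + s) / ((1 + s) * (2 - s)) : ℝ) : ℂ) * (starRingEnd ℂ) w, 2 - s, ?_,
    by linarith, fun z hz => ?_⟩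
  · have h2 : 0 < 2 - s := by linarith
    rw [norm_mul, Complex.norm_real, Real.norm_of_nonneg (by positivity), RCLike.norm_conj,
      div_mul_eq_mul_div, div_lt_one (by positivity)]
    refine lt_of_pow_lt_pow_left₀ 2 (by positivity) ?_
    have h3 : ‖w‖ ^ 2 = 1 - s ^ 2 := by linarith
    rw [mul_pow, h3]
    nlinarith [mul_pos hs0 hs0, mul_pos (mul_pos hs0 hs0) hs0]
  · have hz' : ‖z‖ < 1 := by simpa [unitDisc] using hz
    have hd := one_sub_mul_ne_zero (norm_conj_lt_one hstar) hz'.le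
    have hww : w * (starRingEnd ℂ) w = 1 - (s : ℂ) ^ 2 := by
      rw [Complex.mul_conj']
      exact_mod_cast (by linarith : ‖w‖ ^ 2 = 1 - s ^ 2)
    have h1 : (1 + s : ℂ) ≠ 0 := by exact_mod_cast (by positivity : (1 + s : ℝ) ≠ 0)
    have h2 : (2 - s : ℂ) ≠ 0 := by exact_mod_cast (by linarith : (0:ℝ) < 2 - s).ne'
    rw [eq_div_iff hd, mobius, add_mul, mul_assoc, div_mul_cancel₀ _ hd, hw']
    simp only [map_mul, conj_ofReal]
    push_cast
    field_simp
    linear_combination hww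

lemma norm_conj_mul_mobius_lt_one {w a z : ℂ} (hw : w ∈ unitDisc) (ha : a ∈ unitDisc)
    (hz : z ∈ unitDisc) : ‖(starRingEnd ℂ) w * mobius a z‖ < 1 := by
  have h1 := norm_conj_lt_one hw
  have h2 := one_sub_norm_mobius_sq_nonneg ha hz
  have h3 : ‖mobius a z‖ ≤ 1 := by nlinarith [norm_nonneg (mobius a z)]
  rw [norm_mul]
  nlinarith [norm_nonneg (mobius a z), norm_nonneg ((starRingEnd ℂ) w)]

lemma re_exp_one_div_nonneg {h : ℂ} (h0 : 0 ≤ h.re) : 0 ≤ ((Real.exp 1 : ℂ) / h).re := by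
  rw [div_eq_mul_inv, Complex.re_ofReal_mul, Complex.inv_re]
  have := Complex.normSq_nonneg h
  positivity

lemma re_log_exp_one_div {h : ℂ} (h0 : h ≠ 0) :
    (Complex.log ((Real.exp 1 : ℂ) / h)).re = 1 - Real.log ‖h‖ := by
  rw [Complex.log_re, norm_div, Real.log_div (by simp) (norm_ne_zero_iff.2 h0),
    Complex.norm_real, Real.norm_of_nonneg (Real.exp_pos 1).le, Real.log_exp]

lemma deriv_log_exp_div_quotient {α β k z : ℂ} {f : ℂ → ℂ}
    (hα : 1 - α * z ≠ 0) (hβ : 1 - β * z ≠ 0)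
    (hf : f =ᶠ[nhds z] fun z => k * (1 - β * z) / (1 - α * z)) (hre : 0 < (f z).re) :
    deriv (fun z => Complex.log ((Real.exp 1 : ℂ) / f z)) z =
      β * (1 - β * z)⁻¹ - α * (1 - α * z)⁻¹ := by
  have hfz : f z ≠ 0 := fun h => by simp [h] at hre
  have hz := hf.self_of_nhds
  have hk : k ≠ 0 := fun h => hfz (by simp [hz, h])
  have hlin : ∀ γ : ℂ, HasDerivAt (fun z => 1 - γ * z) (-γ) z := fun γ => by
    simpa using ((hasDerivAt_id z).const_mul γ).const_sub 1
  have hd := (((hlin β).const_mul k).div (hlin α) hα).congr_of_eventuallyEq hf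
  have he : (Real.exp 1 : ℂ) ≠ 0 := by exact_mod_cast (Real.exp_pos 1).ne'
  have hslit : (Real.exp 1 : ℂ) / f z ∈ slitPlane := by
    left
    rw [div_eq_mul_inv, Complex.re_ofReal_mul, Complex.inv_re]
    have := Complex.normSq_pos.2 hfz
    positivity
  refine (((hasDerivAt_const z (Real.exp 1 : ℂ)).div hd hfz).clog hslit).deriv.trans ?_
  simp only [Pi.div_apply]
  rw [hz]
  have hα' : 1 - z * α ≠ 0 := by rwa [mul_comm]
  have hβ' : 1 - z * β ≠ 0 := by rwa [mul_comm]
  field_simp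
  ring

lemma re_one_add_pos {u : ℂ} (hu : ‖u‖ < 1) : 0 < (1 + u).re := by
  have := (abs_le.1 (Complex.abs_re_le_norm u)).1
  rw [Complex.add_re, Complex.one_re]
  linarith

lemma exists_deriv_betaB {w : ℂ} (hw : w ∈ unitDisc) (hw0 : w ≠ 0) :
    ∃ α β : ℂ, ‖α‖ < 1 ∧ ‖β‖ < 1 ∧ ∀ z ∈ unitDisc,
      deriv (betaB w) z = β * (1 - β * z)⁻¹ - α * (1 - α * z)⁻¹ := by
  obtain ⟨hs, β, k, hβ, -, hq⟩ := exists_kernel_quotient hw hw0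
  refine ⟨(starRingEnd ℂ) (wstar w), β, norm_conj_lt_one hs, hβ, fun z hz => ?_⟩
  have hz' : ‖z‖ ≤ 1 := by simpa [unitDisc] using Metric.ball_subset_closedBall hz
  exact deriv_log_exp_div_quotient (one_sub_mul_ne_zero (norm_conj_lt_one hs) hz')
    (one_sub_mul_ne_zero hβ hz')
    (Filter.eventually_of_mem (Metric.isOpen_ball.mem_nhds hz) hq)
    (re_one_add_pos (norm_conj_mul_mobius_lt_one hw hs hz))

lemma bmoaSemi_le_of_deriv_eq {f : ℂ → ℂ} {α β a : ℂ} (hα : ‖α‖ < 1) (hβ : ‖β‖ < 1)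
    (hf : ∀ z ∈ unitDisc, deriv f z = β * (1 - β * z)⁻¹ - α * (1 - α * z)⁻¹)
    (ha : a ∈ unitDisc) : bmoaSemi f a ≤ 32 := by
  have hD : MeasurableSet unitDisc := measurableSet_ball
  have hle : ∫ z in unitDisc, ‖deriv f z‖ ^ 2 * (1 - ‖mobius a z‖ ^ 2) ≤
      ∫ z in unitDisc, (2 * (‖(1 - β * z)⁻¹‖ ^ 2 * (1 - ‖mobius a z‖ ^ 2)) +
        2 * (‖(1 - α * z)⁻¹‖ ^ 2 * (1 - ‖mobius a z‖ ^ 2))) := by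
    refine integral_mono_of_nonneg ((ae_restrict_iff' hD).2 (ae_of_all _ fun z hz => ?_))
      (((integrableOn_kernel_weight ha hβ).const_mul 2).add
        ((integrableOn_kernel_weight ha hα).const_mul 2))
      ((ae_restrict_iff' hD).2 (ae_of_all _ fun z hz => ?_))
    · exact mul_nonneg (by positivity) (one_sub_norm_mobius_sq_nonneg ha hz)
    · have h0 := one_sub_norm_mobius_sq_nonneg ha hz
      have h1 : ‖deriv f z‖ ≤ ‖(1 - β * z)⁻¹‖ + ‖(1 - α * z)⁻¹‖ := by
        rw [hf z hz]
        refine (norm_sub_le _ _).trans ?_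
        rw [norm_mul, norm_mul]
        exact add_le_add (mul_le_of_le_one_left (norm_nonneg _) hβ.le)
          (mul_le_of_le_one_left (norm_nonneg _) hα.le)
      have h2 : ‖deriv f z‖ ^ 2 ≤ 2 * ‖(1 - β * z)⁻¹‖ ^ 2 + 2 * ‖(1 - α * z)⁻¹‖ ^ 2 := by
        have := pow_le_pow_left₀ (norm_nonneg _) h1 2
        nlinarith [sq_nonneg (‖(1 - β * z)⁻¹‖ - ‖(1 - α * z)⁻¹‖)]
      refine (mul_le_mul_of_nonneg_right h2 h0).trans (le_of_eq ?_)
      ring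
  rw [integral_add ((integrableOn_kernel_weight ha hβ).const_mul 2)
    ((integrableOn_kernel_weight ha hα).const_mul 2), integral_const_mul,
    integral_const_mul] at hle
  rw [bmoaSemi, inv_mul_le_iff₀ Real.pi_pos]
  linarith [integral_kernel_weight_le ha hα, integral_kernel_weight_le ha hβ]

lemma norm_kernel_mul_le {α z : ℂ} (hα : ‖α‖ < 1) (hz : z ∈ unitDisc) :
    ‖α * (1 - α * z)⁻¹‖ * (1 - ‖z‖ ^ 2) ≤ 2 := by
  have hz' : ‖z‖ < 1 := by simpa [unitDisc] using hz
  have h1 : 1 - ‖z‖ ≤ ‖1 - α * z‖ := by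
    have := norm_sub_norm_le (1 : ℂ) (α * z)
    rw [norm_one, norm_mul] at this
    nlinarith [norm_nonneg z]
  have h2 : 0 < ‖1 - α * z‖ := by linarith
  rw [norm_mul, norm_inv, ← div_eq_mul_inv, div_mul_eq_mul_div, div_le_iff₀ h2]
  have h3 : ‖α‖ * (1 - ‖z‖ ^ 2) ≤ 1 - ‖z‖ ^ 2 :=
    mul_le_of_le_one_left (by nlinarith [norm_nonneg z]) hα.le
  nlinarith [norm_nonneg z]

lemma blochSemi_le_of_deriv_eq {f : ℂ → ℂ} {α β z : ℂ} (hα : ‖α‖ < 1) (hβ : ‖β‖ < 1)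
    (hz : z ∈ unitDisc) (hf : deriv f z = β * (1 - β * z)⁻¹ - α * (1 - α * z)⁻¹) :
    blochSemi f z ≤ 4 := by
  have hz' : ‖z‖ < 1 := by simpa [unitDisc] using hz
  rw [blochSemi, hf]
  refine (mul_le_mul_of_nonneg_right (norm_sub_le _ _) (by nlinarith [norm_nonneg z])).trans ?_
  rw [add_mul]
  linarith [norm_kernel_mul_le hα hz, norm_kernel_mul_le hβ hz]

lemma abs_im_betaB_le {w z : ℂ} (hw : w ∈ unitDisc) (hw0 : w ≠ 0) (hz : z ∈ unitDisc) :
    |(betaB w z).im| ≤ Real.pi / 2 := by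
  have hre := re_one_add_pos
    (norm_conj_mul_mobius_lt_one hw (exists_kernel_quotient hw hw0).1 hz)
  rw [betaB, Complex.log_im]
  exact Complex.abs_arg_le_pi_div_two_iff.2 (re_exp_one_div_nonneg hre.le)

lemma re_betaB_nonneg {w z : ℂ} (hw : w ∈ unitDisc) (hw0 : w ≠ 0) (hz : z ∈ unitDisc) :
    0 ≤ (betaB w z).re := by
  have hu := norm_conj_mul_mobius_lt_one hw (exists_kernel_quotient hw hw0).1 hz
  have hne : 1 + (starRingEnd ℂ) w * mobius (wstar w) z ≠ 0 := fun h => by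
    have := re_one_add_pos hu
    simp [h] at this
  rw [betaB, re_log_exp_one_div hne]
  have h1 : ‖1 + (starRingEnd ℂ) w * mobius (wstar w) z‖ ≤ 2 := by
    refine (norm_add_le _ _).trans ?_
    rw [norm_one]
    linarith
  linarith [Real.log_le_sub_one_of_pos (norm_pos_iff.2 hne)]

lemma norm_betaB_zero_le {w : ℂ} (hw : w ∈ unitDisc) (hw0 : w ≠ 0) : ‖betaB w 0‖ ≤ 3 := by
  have h0 : (0 : ℂ) ∈ unitDisc := by simp [unitDisc]
  obtain ⟨-, β, k, -, hk, hq⟩ := exists_kernel_quotient hw hw0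
  have h := hq 0 h0
  simp only [mul_zero, sub_zero, mul_one, div_one] at h
  have hk0 : (k : ℂ) ≠ 0 := by exact_mod_cast (by linarith : (0 : ℝ) < k).ne'
  have hre : (betaB w 0).re ≤ 1 := by
    rw [betaB, h, re_log_exp_one_div hk0, Complex.norm_real, Real.norm_of_nonneg (by linarith)]
    linarith [Real.log_nonneg hk]
  have := Complex.norm_le_abs_re_add_abs_im (betaB w 0)
  rw [abs_of_nonneg (re_betaB_nonneg hw hw0 h0)] at this
  linarith [abs_im_betaB_le hw hw0 h0, Real.pi_le_four]

/-- There is an absolute constant `C > 0` such that each building block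
`β_w` has `BMOA` seminorm, Bloch seminorm and value at the origin bounded by `C`,
nonnegative real part, and imaginary part bounded by `π/2`. -/
theorem betaB_basic_properties :
    ∃ C > 0, ∀ w ∈ unitDisc, w ≠ 0 →
      ((∀ a ∈ unitDisc, bmoaSemi (betaB w) a ≤ C) ∧
        (∀ z ∈ unitDisc, blochSemi (betaB w) z ≤ C) ∧
        ‖betaB w 0‖ ≤ C) ∧
      (∀ z ∈ unitDisc, 0 ≤ (betaB w z).re) ∧
      (∀ z ∈ unitDisc, |(betaB w z).im| ≤ Real.pi / 2) := by
  refine ⟨32, by norm_num, fun w hw hw0 => ?_⟩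
  obtain ⟨α, β, hα, hβ, hd⟩ := exists_deriv_betaB hw hw0
  exact ⟨⟨fun a ha => bmoaSemi_le_of_deriv_eq hα hβ hd ha,
    fun z hz => (blochSemi_le_of_deriv_eq hα hβ hz (hd z hz)).trans (by norm_num),
    (norm_betaB_zero_le hw hw0).trans (by norm_num)⟩,
    fun z hz => re_betaB_nonneg hw hw0 hz, fun z hz => abs_im_betaB_le hw hw0 hz⟩
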